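/- Theorem (product state approximation): For any instance of MAX-k-local Hamiltonian on n qudits with terms H_{i_1,…,i_k} that are positive semidefinite with operator norm ≤ 1, and with optimal value OPT = λ_max(Σ H_{i_1,…,i_k}), there exists a pure product state |φ_1⟩⊗···⊗|φ_n⟩ with ⟨φ|H|φ⟩ ≥ OPT/d^{k−1}. -/

import Mathlib

open Matrix BigOperators ComplexOrder

/-- An operator on `n` qudits acts only on the qudits indexed by `S`. -/
def ActsOn {n d : ℕ} (S : Finset (Fin n)) (M : Matrix (Fin n → Fin d) (Fin n → Fin d) ℂ) : Prop :=
  (∀ x y : Fin n → Fin d, (∃ j ∉ S, x j ≠ y j) → M x y = 0) ∧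
  ∀ x y x' y' : Fin n → Fin d, (∀ j ∈ S, x j = x' j) → (∀ j ∈ S, y j = y' j) →
    (∀ j ∉ S, x j = y j) → (∀ j ∉ S, x' j = y' j) → M x y = M x' y'

/-- The tensor product of a vector of the first qudit with a vector of the remaining qudits. -/
def headTensor {n d : ℕ} (a : Fin d → ℂ) (c : (Fin n → Fin d) → ℂ) : (Fin (n + 1) → Fin d) → ℂ :=
  fun x => a (x 0) * c (Fin.tail x)

/-- The matrix of the map `c ↦ headTensor a c`. -/
def headTensorMatrix {d : ℕ} (n : ℕ) (a : Fin d → ℂ) :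
    Matrix (Fin (n + 1) → Fin d) (Fin n → Fin d) ℂ :=
  fun x u => if Fin.tail x = u then a (x 0) else 0

lemma sum_fin_succ_fun {n d : ℕ} {R : Type*} [AddCommMonoid R] (f : (Fin (n + 1) → Fin d) → R) :
    ∑ x, f x = ∑ x : Fin d, ∑ u : Fin n → Fin d, f (Fin.cons x u) := by
  rw [← Fintype.sum_prod_type']
  exact (Fintype.sum_equiv (Fin.consEquiv (fun _ : Fin (n + 1) => Fin d)) _ _ (fun _ => rfl)).symm

lemma headTensorMatrix_mulVec {n d : ℕ} (a : Fin d → ℂ) (c : (Fin n → Fin d) → ℂ) :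
    headTensorMatrix n a *ᵥ c = headTensor a c := by
  ext x
  simp [headTensorMatrix, headTensor, mulVec, dotProduct]

lemma star_dotProduct_compression {n d : ℕ} (a : Fin d → ℂ) (c : (Fin n → Fin d) → ℂ)
    (M : Matrix (Fin (n + 1) → Fin d) (Fin (n + 1) → Fin d) ℂ) :
    star c ⬝ᵥ (((headTensorMatrix n a)ᴴ * M * headTensorMatrix n a) *ᵥ c) =
      star (headTensor a c) ⬝ᵥ (M *ᵥ headTensor a c) := by
  rw [← headTensorMatrix_mulVec, star_mulVec, ← dotProduct_mulVec, mulVec_mulVec, mulVec_mulVec,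
    Matrix.mul_assoc]

lemma compression_apply {n d : ℕ} (a : Fin d → ℂ)
    (M : Matrix (Fin (n + 1) → Fin d) (Fin (n + 1) → Fin d) ℂ) (u v : Fin n → Fin d) :
    ((headTensorMatrix n a)ᴴ * M * headTensorMatrix n a) u v =
      ∑ y, (∑ x, star (a x) * M (Fin.cons x u) (Fin.cons y v)) * a y := by
  simp [Matrix.mul_apply, sum_fin_succ_fun, headTensorMatrix, apply_ite, ite_mul]

lemma ActsOn.compression {n d : ℕ} {S : Finset (Fin (n + 1))}
    {M : Matrix (Fin (n + 1) → Fin d) (Fin (n + 1) → Fin d) ℂ} (h : ActsOn S M) (a : Fin d → ℂ) :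
    ActsOn (Finset.univ.filter fun j : Fin n => j.succ ∈ S)
      ((headTensorMatrix n a)ᴴ * M * headTensorMatrix n a) := by
  constructor
  · rintro u v ⟨j, hj, hne⟩
    rw [compression_apply]
    refine Finset.sum_eq_zero fun y _ => ?_
    rw [Finset.sum_eq_zero fun x _ => ?_, zero_mul]
    rw [h.1 _ _ ⟨j.succ, by simpa using hj, by simpa using hne⟩, mul_zero]
  · intro u v u' v' hu hv huv huv'
    simp only [Finset.mem_filter, Finset.mem_univ, true_and] at hu hv huv huv'
    rw [compression_apply, compression_apply]
    refine Finset.sum_congr rfl fun y _ => ?_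
    congr 1
    refine Finset.sum_congr rfl fun x _ => ?_
    congr 1
    by_cases hxy : (0 : Fin (n + 1)) ∉ S ∧ x ≠ y
    · rw [h.1 _ _ ⟨0, hxy.1, by simpa using hxy.2⟩, h.1 _ _ ⟨0, hxy.1, by simpa using hxy.2⟩]
    · have hxy' : (0 : Fin (n + 1)) ∉ S → x = y := fun h0 => by
        by_contra hne
        exact hxy ⟨h0, hne⟩
      refine h.2 _ _ _ _ (fun j => ?_) (fun j => ?_) (fun j => ?_) (fun j => ?_) <;>
        refine Fin.cases ?_ (fun j => ?_) j <;> simp_all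

lemma star_headTensor_dotProduct {n d : ℕ} (a b : Fin d → ℂ) (c e : (Fin n → Fin d) → ℂ) :
    star (headTensor a c) ⬝ᵥ headTensor b e = (star a ⬝ᵥ b) * (star c ⬝ᵥ e) := by
  simp only [dotProduct, sum_fin_succ_fun, headTensor, Pi.star_apply, Fin.cons_zero, Fin.tail_cons,
    star_mul', Finset.sum_mul_sum]
  exact Finset.sum_congr rfl fun _ _ => Finset.sum_congr rfl fun _ _ => by ring

lemma star_headTensor_dotProduct_mulVec {n d : ℕ} (a b : Fin d → ℂ) (c e : (Fin n → Fin d) → ℂ)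
    (M : Matrix (Fin (n + 1) → Fin d) (Fin (n + 1) → Fin d) ℂ) :
    star (headTensor a c) ⬝ᵥ (M *ᵥ headTensor b e) =
      ∑ x, ∑ u, ∑ y, ∑ v, star (a x) * star (c u) * M (Fin.cons x u) (Fin.cons y v) * b y * e v := by
  simp only [dotProduct, mulVec, sum_fin_succ_fun, headTensor, Pi.star_apply, Fin.cons_zero,
    Fin.tail_cons, star_mul', Finset.mul_sum]
  exact Finset.sum_congr rfl fun _ _ => Finset.sum_congr rfl fun _ _ =>
    Finset.sum_congr rfl fun _ _ => Finset.sum_congr rfl fun _ _ => by ring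

lemma ActsOn.cross_term_eq_zero_of_head_notMem {n d : ℕ} {S : Finset (Fin (n + 1))}
    {M : Matrix (Fin (n + 1) → Fin d) (Fin (n + 1) → Fin d) ℂ} (h : ActsOn S M) (h0 : 0 ∉ S)
    {a b : Fin d → ℂ} (hab : star a ⬝ᵥ b = 0) (c e : (Fin n → Fin d) → ℂ) :
    star (headTensor a c) ⬝ᵥ (M *ᵥ headTensor b e) = 0 := by
  rcases isEmpty_or_nonempty (Fin d) with hd | ⟨⟨z⟩⟩
  · simp
  have hM : ∀ x y u v, M (Fin.cons x u) (Fin.cons y v) =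
      if x = y then M (Fin.cons z u) (Fin.cons z v) else 0 := by
    intro x y u v
    split_ifs with hxy
    · subst hxy
      by_cases huv : ∃ j : Fin n, j.succ ∉ S ∧ u j ≠ v j
      · obtain ⟨j, hj, hne⟩ := huv
        rw [h.1 _ _ ⟨j.succ, hj, by simpa using hne⟩, h.1 _ _ ⟨j.succ, hj, by simpa using hne⟩]
      · push Not at huv
        refine h.2 _ _ _ _ (fun j => ?_) (fun j => ?_) (fun j => ?_) (fun j => ?_) <;>
          refine Fin.cases ?_ (fun j => ?_) j <;> simp_all
    · exact h.1 _ _ ⟨0, h0, by simpa using hxy⟩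
  calc star (headTensor a c) ⬝ᵥ (M *ᵥ headTensor b e)
      = ∑ x, star (a x) * b x * ∑ u, ∑ v, star (c u) * M (Fin.cons z u) (Fin.cons z v) * e v := by
        rw [star_headTensor_dotProduct_mulVec]
        refine Finset.sum_congr rfl fun x _ => ?_
        rw [Finset.mul_sum]
        refine Finset.sum_congr rfl fun u _ => ?_
        rw [Finset.sum_comm, Finset.mul_sum]
        refine Finset.sum_congr rfl fun v _ => ?_
        simp only [hM x, mul_ite, ite_mul, mul_zero, zero_mul, Finset.sum_ite_eq, Finset.mem_univ,
          if_true]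
        ring
    _ = 0 := by
        rw [← Finset.sum_mul]
        simp only [dotProduct, Pi.star_apply] at hab
        rw [hab, zero_mul]

lemma ActsOn.cross_term_eq_zero_of_tail_notMem {n d : ℕ} {S : Finset (Fin (n + 1))}
    {M : Matrix (Fin (n + 1) → Fin d) (Fin (n + 1) → Fin d) ℂ} (h : ActsOn S M)
    (hS : ∀ j : Fin n, j.succ ∉ S) (a b : Fin d → ℂ) {c e : (Fin n → Fin d) → ℂ}
    (hce : star c ⬝ᵥ e = 0) :
    star (headTensor a c) ⬝ᵥ (M *ᵥ headTensor b e) = 0 := by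
  rcases isEmpty_or_nonempty (Fin n → Fin d) with hd | ⟨⟨z⟩⟩
  · simp [star_headTensor_dotProduct_mulVec]
  have hM : ∀ x y u v, M (Fin.cons x u) (Fin.cons y v) =
      if u = v then M (Fin.cons x z) (Fin.cons y z) else 0 := by
    intro x y u v
    split_ifs with huv
    · subst huv
      by_cases hxy : (0 : Fin (n + 1)) ∉ S ∧ x ≠ y
      · rw [h.1 _ _ ⟨0, hxy.1, by simpa using hxy.2⟩, h.1 _ _ ⟨0, hxy.1, by simpa using hxy.2⟩]
      · have hxy' : (0 : Fin (n + 1)) ∉ S → x = y := fun h0 => by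
          by_contra hne
          exact hxy ⟨h0, hne⟩
        refine h.2 _ _ _ _ (fun j => ?_) (fun j => ?_) (fun j => ?_) (fun j => ?_) <;>
          refine Fin.cases ?_ (fun j => ?_) j <;> simp_all
    · obtain ⟨j, hj⟩ := Function.ne_iff.mp huv
      exact h.1 _ _ ⟨j.succ, hS j, by simpa using hj⟩
  calc star (headTensor a c) ⬝ᵥ (M *ᵥ headTensor b e)
      = ∑ x, ∑ y, (∑ u, star (c u) * e u) *
          (star (a x) * M (Fin.cons x z) (Fin.cons y z) * b y) := by
        rw [star_headTensor_dotProduct_mulVec]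
        refine Finset.sum_congr rfl fun x _ => ?_
        rw [Finset.sum_comm]
        refine Finset.sum_congr rfl fun y _ => ?_
        rw [Finset.sum_mul]
        refine Finset.sum_congr rfl fun u _ => ?_
        simp only [hM x y u, mul_ite, ite_mul, mul_zero, zero_mul, Finset.sum_ite_eq,
          Finset.mem_univ, if_true]
        ring
    _ = 0 := by
        simp only [dotProduct, Pi.star_apply] at hce
        simp only [hce, zero_mul, Finset.sum_const_zero]

lemma star_sum_dotProduct_mulVec_sum {ι m : Type*} [Fintype ι] [Fintype m] (M : Matrix m m ℂ)
    (w : ι → m → ℂ) :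
    star (∑ i, w i) ⬝ᵥ (M *ᵥ ∑ i, w i) = ∑ i, ∑ j, star (w i) ⬝ᵥ (M *ᵥ w j) := by
  rw [star_sum, sum_dotProduct]
  refine Finset.sum_congr rfl fun i _ => ?_
  rw [mulVec_sum, dotProduct_sum]

lemma star_sum_dotProduct_mulVec_sum_of_orthogonal {ι m : Type*} [Fintype ι] [Fintype m]
    (M : Matrix m m ℂ) (w : ι → m → ℂ) (hw : ∀ i j, i ≠ j → star (w i) ⬝ᵥ (M *ᵥ w j) = 0) :
    star (∑ i, w i) ⬝ᵥ (M *ᵥ ∑ i, w i) = ∑ i, star (w i) ⬝ᵥ (M *ᵥ w i) := by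
  rw [star_sum_dotProduct_mulVec_sum]
  exact Finset.sum_congr rfl fun i _ => Finset.sum_eq_single i
    (fun j _ hj => hw i j hj.symm) (fun hi => absurd (Finset.mem_univ i) hi)

/-- The pinching inequality for a positive semidefinite quadratic form. -/
lemma Matrix.PosSemidef.re_star_sum_dotProduct_mulVec_sum_le {ι m : Type*} [Fintype ι] [Fintype m]
    {M : Matrix m m ℂ} (hM : M.PosSemidef) (w : ι → m → ℂ) :
    (star (∑ i, w i) ⬝ᵥ (M *ᵥ ∑ i, w i)).re ≤
      Fintype.card ι * ∑ i, (star (w i) ⬝ᵥ (M *ᵥ w i)).re := by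
  have hnonneg : 0 ≤ ∑ i, ∑ j, (star (w i - w j) ⬝ᵥ (M *ᵥ (w i - w j))).re :=
    Finset.sum_nonneg fun i _ => Finset.sum_nonneg fun j _ => hM.re_dotProduct_nonneg _
  have hcomm : ∑ i, ∑ j, (star (w j) ⬝ᵥ (M *ᵥ w i)).re =
      ∑ i, ∑ j, (star (w i) ⬝ᵥ (M *ᵥ w j)).re := Finset.sum_comm
  simp only [star_sub, mulVec_sub, sub_dotProduct, dotProduct_sub, Complex.sub_re,
    Finset.sum_sub_distrib, Finset.sum_const, Finset.card_univ, nsmul_eq_mul, hcomm,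
    ← Finset.mul_sum] at hnonneg
  rw [star_sum_dotProduct_mulVec_sum]
  simp only [Complex.re_sum]
  linarith

/-- The Schmidt decomposition across the first qudit, with unnormalised second factors. -/
lemma exists_schmidt_decomposition {n d : ℕ} (ψ : (Fin (n + 1) → Fin d) → ℂ) :
    ∃ (a : Fin d → Fin d → ℂ) (c : Fin d → (Fin n → Fin d) → ℂ),
      ψ = ∑ i, headTensor (a i) (c i) ∧ (∀ i, star (a i) ⬝ᵥ a i = 1) ∧
      (∀ i j, i ≠ j → star (a i) ⬝ᵥ a j = 0) ∧ ∀ i j, i ≠ j → star (c i) ⬝ᵥ c j = 0 := by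
  let Ψ : Matrix (Fin d) (Fin n → Fin d) ℂ := fun x u => ψ (Fin.cons x u)
  have hG : (Ψ * Ψᴴ).IsHermitian := isHermitian_mul_conjTranspose_self Ψ
  let U : Matrix (Fin d) (Fin d) ℂ := hG.eigenvectorUnitary
  have hUU : Uᴴ * U = 1 := Unitary.coe_star_mul_self hG.eigenvectorUnitary
  have hUU' : U * Uᴴ = 1 := Unitary.coe_mul_star_self hG.eigenvectorUnitary
  have hdiag : (Uᴴ * Ψ) * (Uᴴ * Ψ)ᴴ = diagonal (fun i => (hG.eigenvalues i : ℂ)) := by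
    have hspec : Ψ * Ψᴴ = U * diagonal (fun i => (hG.eigenvalues i : ℂ)) * Uᴴ :=
      hG.spectral_theorem
    calc (Uᴴ * Ψ) * (Uᴴ * Ψ)ᴴ = Uᴴ * (Ψ * Ψᴴ) * U := by
          simp only [conjTranspose_mul, conjTranspose_conjTranspose, Matrix.mul_assoc]
      _ = (Uᴴ * U) * diagonal (fun i => (hG.eigenvalues i : ℂ)) * (Uᴴ * U) := by
          refine (congrArg (fun A => Uᴴ * A * U) hspec).trans ?_
          simp only [Matrix.mul_assoc]
      _ = _ := by rw [hUU, Matrix.one_mul, Matrix.mul_one]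
  have hU : ∀ i j, star (fun x => U x i) ⬝ᵥ (fun x => U x j) = (1 : Matrix (Fin d) (Fin d) ℂ) i j :=
    fun i j => by rw [← hUU]; rfl
  refine ⟨fun i x => U x i, fun i => (Uᴴ * Ψ) i, ?_, fun i => by simp [hU], fun i j hij => by
    rw [hU, one_apply_ne hij], fun i j hij => ?_⟩
  · ext x
    have hΨ : Ψ = U * (Uᴴ * Ψ) := by rw [← Matrix.mul_assoc, hUU', Matrix.one_mul]
    have hx : ψ x = Ψ (x 0) (Fin.tail x) := by simp [Ψ]
    rw [hx, hΨ, mul_apply, ← hΨ]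
    simp [headTensor, Finset.sum_apply]
  · rw [dotProduct_comm]
    change ((Uᴴ * Ψ) * (Uᴴ * Ψ)ᴴ) j i = 0
    rw [hdiag, diagonal_apply_ne _ hij.symm]

/-- Dephasing in a Schmidt basis of the first qudit costs a factor `d` only for the terms that act
on the first qudit and on some other qudit. -/
lemma ActsOn.re_schmidt_div_le {n d : ℕ} (hd : 0 < d) {S : Finset (Fin (n + 1))}
    {M : Matrix (Fin (n + 1) → Fin d) (Fin (n + 1) → Fin d) ℂ} (h : ActsOn S M)
    (hM : M.PosSemidef) {a : Fin d → Fin d → ℂ} {c : Fin d → (Fin n → Fin d) → ℂ}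
    (ha : ∀ i j, i ≠ j → star (a i) ⬝ᵥ a j = 0) (hc : ∀ i j, i ≠ j → star (c i) ⬝ᵥ c j = 0) :
    (star (∑ i, headTensor (a i) (c i)) ⬝ᵥ (M *ᵥ ∑ i, headTensor (a i) (c i))).re /
        (d : ℝ) ^ (S.card - 1) ≤
      ∑ i, (star (headTensor (a i) (c i)) ⬝ᵥ (M *ᵥ headTensor (a i) (c i))).re /
        (d : ℝ) ^ ((Finset.univ.filter fun j : Fin n => j.succ ∈ S).card - 1) := by
  have hcard : S.card = (if (0 : Fin (n + 1)) ∈ S then 1 else 0) +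
      (Finset.univ.filter fun j : Fin n => j.succ ∈ S).card := by
    have := Fin.card_filter_univ_succ (fun j : Fin (n + 1) => j ∈ S)
    simp only [Finset.filter_univ_mem] at this
    rw [this]
    split_ifs <;> simp [add_comm]
  rw [← Finset.sum_div]
  set s := (Finset.univ.filter fun j : Fin n => j.succ ∈ S).card with hs
  by_cases h0 : (0 : Fin (n + 1)) ∈ S
  · rw [if_pos h0] at hcard
    rcases Nat.eq_zero_or_pos s with hs0 | hs0
    · have hS : ∀ j : Fin n, j.succ ∉ S := by
        rw [hs0, eq_comm, Finset.card_eq_zero, Finset.filter_eq_empty_iff] at hs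
        exact fun j => hs (Finset.mem_univ j)
      rw [star_sum_dotProduct_mulVec_sum_of_orthogonal _ _ fun i j hij =>
        h.cross_term_eq_zero_of_tail_notMem hS _ _ (hc i j hij), Complex.re_sum, hcard, hs0]
    · obtain ⟨r, hr⟩ : ∃ r, s = r + 1 := ⟨s - 1, by omega⟩
      have hpinch := hM.re_star_sum_dotProduct_mulVec_sum_le fun i => headTensor (a i) (c i)
      rw [Fintype.card_fin] at hpinch
      have hd' : (0 : ℝ) < d := by exact_mod_cast hd
      rw [hcard, hr, show 1 + (r + 1) - 1 = r + 1 by omega, show r + 1 - 1 = r by omega,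
        div_le_div_iff₀ (by positivity) (by positivity), pow_succ]
      calc _ ≤ _ := mul_le_mul_of_nonneg_right hpinch (by positivity)
        _ = _ := by ring
  · rw [if_neg h0, zero_add] at hcard
    rw [star_sum_dotProduct_mulVec_sum_of_orthogonal _ _ fun i j hij =>
      h.cross_term_eq_zero_of_head_notMem h0 (ha i j hij) _ _, Complex.re_sum, hcard]

/-- The product of the one-qudit vectors `g j`. -/
def productVector {n d : ℕ} (g : Fin n → Fin d → ℂ) : (Fin n → Fin d) → ℂ :=
  fun v => ∏ j, g j (v j)

lemma productVector_cons {n d : ℕ} (a : Fin d → ℂ) (g : Fin n → Fin d → ℂ) :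
    productVector (Fin.cons a g : Fin (n + 1) → Fin d → ℂ) = headTensor a (productVector g) := by
  ext v
  simp [productVector, headTensor, Fin.prod_univ_succ, Fin.tail]

/-- For every vector there is a product state that does at least as well on every sum of local
terms, up to a factor `d ^ (|S t| - 1)` for the term that acts on `S t`. -/
theorem exists_productVector_ge {d : ℕ} (hd : 0 < d) {T : Type*} [Fintype T] (n : ℕ)
    (S : T → Finset (Fin n)) (M : T → Matrix (Fin n → Fin d) (Fin n → Fin d) ℂ)
    (hM : ∀ t, (M t).PosSemidef) (hS : ∀ t, ActsOn (S t) (M t)) (ψ : (Fin n → Fin d) → ℂ) :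
    ∃ g : Fin n → Fin d → ℂ, (∀ j, star (g j) ⬝ᵥ g j = 1) ∧
      ∑ t, (star ψ ⬝ᵥ (M t *ᵥ ψ)).re / (d : ℝ) ^ ((S t).card - 1) ≤
        (star ψ ⬝ᵥ ψ).re * ∑ t, (star (productVector g) ⬝ᵥ (M t *ᵥ productVector g)).re := by
  induction n with
  | zero =>
    refine ⟨Fin.elim0, fun j => j.elim0, ?_⟩
    rw [Finset.mul_sum]
    refine Finset.sum_le_sum fun t _ => ?_
    have hcard : (S t).card = 0 := by simp [Finset.eq_empty_of_isEmpty]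
    have him := (hM t).1.apply default default
    simp only [hcard, productVector, dotProduct, mulVec, Finset.univ_unique, Finset.sum_singleton,
      Finset.univ_eq_empty, Finset.prod_empty, Pi.star_apply, star_one, one_mul, mul_one,
      zero_tsub, pow_zero, div_one]
    have : (star (ψ default) * ψ default).im = 0 := by simp; ring
    rw [mul_left_comm, mul_comm, Complex.mul_re, this]
    simp
  | succ n ih =>
    obtain ⟨a, c, hψ, ha1, ha, hc⟩ := exists_schmidt_decomposition ψ
    choose g hg hgle using fun i => ih
      (fun t => Finset.univ.filter fun j : Fin n => j.succ ∈ S t)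
      (fun t => (headTensorMatrix n (a i))ᴴ * M t * headTensorMatrix n (a i))
      (fun t => (hM t).conjTranspose_mul_mul_same _) (fun t => (hS t).compression _) (c i)
    simp only [star_dotProduct_compression, ← productVector_cons] at hgle
    have : Nonempty (Fin d) := ⟨⟨0, hd⟩⟩
    obtain ⟨i₀, hi₀⟩ := Finite.exists_max fun i => ∑ t,
      (star (productVector (Fin.cons (a i) (g i) : Fin (n + 1) → Fin d → ℂ)) ⬝ᵥ
        (M t *ᵥ productVector (Fin.cons (a i) (g i) : Fin (n + 1) → Fin d → ℂ))).re
    refine ⟨Fin.cons (a i₀) (g i₀), fun j => Fin.cases (by simpa using ha1 i₀)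
      (fun j => by simpa using hg i₀ j) j, ?_⟩
    have hnorm : (star ψ ⬝ᵥ ψ).re = ∑ i, (star (c i) ⬝ᵥ c i).re := by
      have hcross := star_sum_dotProduct_mulVec_sum_of_orthogonal
        (1 : Matrix (Fin (n + 1) → Fin d) (Fin (n + 1) → Fin d) ℂ)
        (fun i => headTensor (a i) (c i)) fun i j hij => by
          rw [one_mulVec, star_headTensor_dotProduct, ha i j hij, zero_mul]
      simp only [one_mulVec, star_headTensor_dotProduct, ha1, one_mul, ← hψ] at hcross
      rw [hcross, Complex.re_sum]
    calc ∑ t, (star ψ ⬝ᵥ (M t *ᵥ ψ)).re / (d : ℝ) ^ ((S t).card - 1)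
        ≤ ∑ t, ∑ i, (star (headTensor (a i) (c i)) ⬝ᵥ (M t *ᵥ headTensor (a i) (c i))).re /
            (d : ℝ) ^ ((Finset.univ.filter fun j : Fin n => j.succ ∈ S t).card - 1) := by
          rw [hψ]
          exact Finset.sum_le_sum fun t _ => (hS t).re_schmidt_div_le hd (hM t) ha hc
      _ ≤ ∑ i, (star (c i) ⬝ᵥ c i).re * _ := by
          rw [Finset.sum_comm]
          exact Finset.sum_le_sum fun i _ => hgle i
      _ ≤ ∑ i, (star (c i) ⬝ᵥ c i).re * _ := Finset.sum_le_sum fun i _ =>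
          mul_le_mul_of_nonneg_left (hi₀ i)
            (Complex.nonneg_iff.mp (dotProduct_star_self_nonneg (c i))).1
      _ = _ := by rw [hnorm, Finset.sum_mul]

lemma isCompact_setOf_star_dotProduct_self_eq_one (m : Type*) [Fintype m] :
    IsCompact {x : m → ℂ | star x ⬝ᵥ x = 1} := by
  refine Metric.isCompact_of_isClosed_isBounded
    (isClosed_eq (by unfold dotProduct; fun_prop) continuous_const) ?_
  refine (Metric.isBounded_closedBall (x := (0 : m → ℂ)) (r := 1)).subset fun x hx => ?_
  rw [mem_closedBall_zero_iff, pi_norm_le_iff_of_nonneg zero_le_one]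
  intro i
  have hsum : ∑ j, ‖x j‖ ^ 2 = 1 := by
    have := congrArg Complex.re (show star x ⬝ᵥ x = 1 from hx)
    simpa [dotProduct, ← Complex.normSq_eq_norm_sq, Complex.normSq_apply] using this
  have hi : ‖x i‖ ^ 2 ≤ 1 := hsum ▸
    Finset.single_le_sum (f := fun j => ‖x j‖ ^ 2) (fun j _ => sq_nonneg _) (Finset.mem_univ i)
  exact (sq_le_one_iff₀ (norm_nonneg _)).mp hi

/-- Some product state maximises the expected value of an observable among product states. -/
lemma exists_productVector_max {n d : ℕ} (hd : 0 < d)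
    (H : Matrix (Fin n → Fin d) (Fin n → Fin d) ℂ) :
    ∃ g : Fin n → Fin d → ℂ, (∀ j, star (g j) ⬝ᵥ g j = 1) ∧
      ∀ g' : Fin n → Fin d → ℂ, (∀ j, star (g' j) ⬝ᵥ g' j = 1) →
        (star (productVector g') ⬝ᵥ (H *ᵥ productVector g')).re ≤
          (star (productVector g) ⬝ᵥ (H *ᵥ productVector g)).re := by
  have hcompact := isCompact_univ_pi fun _ : Fin n =>
    isCompact_setOf_star_dotProduct_self_eq_one (Fin d)
  have hcont : Continuous fun g : Fin n → Fin d → ℂ =>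
      (star (productVector g) ⬝ᵥ (H *ᵥ productVector g)).re := by
    unfold productVector dotProduct mulVec dotProduct
    simp only [Pi.star_apply]
    fun_prop
  obtain ⟨g, hg, hmax⟩ := hcompact.exists_isMaxOn
    ⟨fun _ => Pi.single ⟨0, hd⟩ 1, fun j _ => by simp⟩ hcont.continuousOn
  exact ⟨g, fun j => hg j (Set.mem_univ j), fun g' hg' => hmax fun j _ => hg' j⟩

/-- Product state approximation theorem: for any MAX-k-local Hamiltonian instance
(a sum of k-local positive semidefinite terms of operator norm at most 1 on `n` qudits)
there is a pure product state whose value is at least `OPT / d^(k-1)`; OPT is expressed by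
quantifying over the Rayleigh quotients of all unit vectors. -/
theorem stmt8 (d n k : ℕ) (hd : 0 < d) {T : Type*} [Fintype T]
    (loc : T → Finset (Fin n)) (hloc : ∀ t, (loc t).card = k)
    (Hterm : T → Matrix (Fin n → Fin d) (Fin n → Fin d) ℂ)
    (hpsd : ∀ t, (Hterm t).PosSemidef)
    (hnorm : ∀ t (x : (Fin n → Fin d) → ℂ),
      (star x ⬝ᵥ ((Hterm t) *ᵥ x)).re ≤ (star x ⬝ᵥ x).re)
    (hlocal0 : ∀ t (x y : Fin n → Fin d), (∃ j ∉ loc t, x j ≠ y j) → Hterm t x y = 0)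
    (hlocal1 : ∀ t (x y x' y' : Fin n → Fin d), (∀ j ∈ loc t, x j = x' j) →
      (∀ j ∈ loc t, y j = y' j) → (∀ j ∉ loc t, x j = y j) → (∀ j ∉ loc t, x' j = y' j) →
      Hterm t x y = Hterm t x' y') :
    ∃ g : Fin n → Fin d → ℂ, (∀ j, star (g j) ⬝ᵥ g j = 1) ∧
      ∀ x : (Fin n → Fin d) → ℂ, star x ⬝ᵥ x = 1 →
        (star x ⬝ᵥ ((∑ t, Hterm t) *ᵥ x)).re / (d : ℝ) ^ (k - 1) ≤
        (star (fun v : Fin n → Fin d => ∏ j, g j (v j)) ⬝ᵥ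
          ((∑ t, Hterm t) *ᵥ (fun v : Fin n → Fin d => ∏ j, g j (v j)))).re := by
  obtain ⟨g, hg, hmax⟩ := exists_productVector_max hd (∑ t, Hterm t)
  refine ⟨g, hg, fun x hx => ?_⟩
  obtain ⟨g', hg', hle⟩ := exists_productVector_ge hd n loc Hterm hpsd
    (fun t => ⟨hlocal0 t, hlocal1 t⟩) x
  have hsum : ∀ y : (Fin n → Fin d) → ℂ, (star y ⬝ᵥ ((∑ t, Hterm t) *ᵥ y)).re =
      ∑ t, (star y ⬝ᵥ (Hterm t *ᵥ y)).re := fun y => by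
    rw [sum_mulVec, dotProduct_sum, Complex.re_sum]
  simp only [hloc, hx, Complex.one_re, one_mul, ← Finset.sum_div, ← hsum] at hle
  exact hle.trans (hmax g' hg')
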